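/- For every n ≥ 2, let H_n be the monoid presented by generators u_{k,l}, ū_{k,l}, w_{k,l} (1 ≤ k ≠ l ≤ n) and c_1,…,c_n subject to the relations (where within each relation distinct letters i,j,k,l denote pairwise distinct indices in {1,…,n}): c_j² = e; c_ic_j = c_jc_i; u_{ij}ū_{ij} = ū_{ij}u_{ij} = e; u_{ij}u_{kl} = u_{kl}u_{ij}; u_{ik}u_{kj}u_{ik} = u_{kj}u_{ik}u_{kj}; u_{ij}c_k = c_ku_{ij}; u_{ij} = c_ic_ju_{ji}c_jc_i; u_{ij}w_{kl} = w_{kl}u_{ij}; u_{ik}u_{kj}w_{ik} = w_{kj}u_{ik}u_{kj}; w_{ik}u_{kj}u_{ik} = u_{kj}u_{ik}w_{kj}; u_{ij}w_{ij} = w_{ij}u_{ij}; w_{ij}w_{kl} = w_{kl}w_{ij}; w_{ij}c_k = c_kw_{ij}; w_{ij} = c_ic_jw_{ji}c_jc_i. Then the assignment u_{k,l} ↦ x_{k,l}, ū_{k,l} ↦ x̄_{k,l}, w_{k,l} ↦ z_{k,l}, c_j ↦ γ_j defines a monoid homomorphism from H_n to STVB_n that is an isomorphism of H_n onto the submonoid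 STVH_n := φ₂⁻¹(identity). -/

import Mathlib

namespace SingTVB

/-- Generators of the singular twisted virtual braid monoid `STVB n`
(0-based indexing: `sig i` is the paper's σ_{i+1}, `gam j` is the paper's γ_{j+1}). -/
inductive Gen (n : ℕ) : Type
  | sig : Fin (n - 1) → Gen n
  | sigb : Fin (n - 1) → Gen n
  | rho : Fin (n - 1) → Gen n
  | tau : Fin (n - 1) → Gen n
  | gam : Fin n → Gen n

abbrev FM (n : ℕ) := FreeMonoid (Gen n)

/-- The strand `i` (lower strand of the `i`-th crossing), as an element of `Fin n`. -/
def fa {n : ℕ} (i : Fin (n - 1)) : Fin n := ⟨i.val, by have := i.isLt; omega⟩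
/-- The strand `i+1` (upper strand of the `i`-th crossing), as an element of `Fin n`. -/
def fb {n : ℕ} (i : Fin (n - 1)) : Fin n := ⟨i.val + 1, by have := i.isLt; omega⟩

def Ws {n : ℕ} (i : Fin (n - 1)) : FM n := FreeMonoid.of (Gen.sig i)
def Wsb {n : ℕ} (i : Fin (n - 1)) : FM n := FreeMonoid.of (Gen.sigb i)
def Wr {n : ℕ} (i : Fin (n - 1)) : FM n := FreeMonoid.of (Gen.rho i)
def Wt {n : ℕ} (i : Fin (n - 1)) : FM n := FreeMonoid.of (Gen.tau i)
def Wg {n : ℕ} (j : Fin n) : FM n := FreeMonoid.of (Gen.gam j)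

/-- `|i - j| > 1`. -/
def Far {m : ℕ} (i j : Fin m) : Prop := i.val + 1 < j.val ∨ j.val + 1 < i.val

/-- Defining relations of the singular twisted virtual braid monoid. -/
inductive Rel (n : ℕ) : FM n → FM n → Prop
  | ss {i j : Fin (n - 1)} (h : Far i j) : Rel n (Ws i * Ws j) (Ws j * Ws i)
  | rr {i j : Fin (n - 1)} (h : Far i j) : Rel n (Wr i * Wr j) (Wr j * Wr i)
  | sr {i j : Fin (n - 1)} (h : Far i j) : Rel n (Ws i * Wr j) (Wr j * Ws i)
  | tt {i j : Fin (n - 1)} (h : Far i j) : Rel n (Wt i * Wt j) (Wt j * Wt i)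
  | st {i j : Fin (n - 1)} (h : Far i j) : Rel n (Ws i * Wt j) (Wt j * Ws i)
  | tr {i j : Fin (n - 1)} (h : Far i j) : Rel n (Wt i * Wr j) (Wr j * Wt i)
  | sss {i j : Fin (n - 1)} (h : j.val = i.val + 1) :
      Rel n (Ws i * Ws j * Ws i) (Ws j * Ws i * Ws j)
  | rrr {i j : Fin (n - 1)} (h : j.val = i.val + 1) :
      Rel n (Wr i * Wr j * Wr i) (Wr j * Wr i * Wr j)
  | rsr {i j : Fin (n - 1)} (h : j.val = i.val + 1) :
      Rel n (Wr i * Ws j * Wr i) (Wr j * Ws i * Wr j)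
  | rtr {i j : Fin (n - 1)} (h : j.val = i.val + 1) :
      Rel n (Wr i * Wt j * Wr i) (Wr j * Wt i * Wr j)
  | sst {i j : Fin (n - 1)} (h : j.val = i.val + 1) :
      Rel n (Ws i * Ws j * Wt i) (Wt j * Ws i * Ws j)
  | sst' {i j : Fin (n - 1)} (h : j.val = i.val + 1) :
      Rel n (Ws j * Ws i * Wt j) (Wt i * Ws j * Ws i)
  | rho2 (i : Fin (n - 1)) : Rel n (Wr i * Wr i) 1
  | ssb (i : Fin (n - 1)) : Rel n (Ws i * Wsb i) 1
  | sbs (i : Fin (n - 1)) : Rel n (Wsb i * Ws i) 1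
  | stc (i : Fin (n - 1)) : Rel n (Ws i * Wt i) (Wt i * Ws i)
  | grel (i : Fin (n - 1)) : Rel n (Wg (fb i) * Wr i) (Wr i * Wg (fa i))
  | rsrg (i : Fin (n - 1)) :
      Rel n (Wr i * Ws i * Wr i) (Wg (fb i) * Wg (fa i) * Ws i * Wg (fa i) * Wg (fb i))
  | rtrg (i : Fin (n - 1)) :
      Rel n (Wr i * Wt i * Wr i) (Wg (fb i) * Wg (fa i) * Wt i * Wg (fa i) * Wg (fb i))
  | g2 (j : Fin n) : Rel n (Wg j * Wg j) 1
  | gg (i j : Fin n) : Rel n (Wg i * Wg j) (Wg j * Wg i)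
  | grc {i : Fin (n - 1)} {j : Fin n} (h1 : j ≠ fa i) (h2 : j ≠ fb i) :
      Rel n (Wg j * Wr i) (Wr i * Wg j)
  | sgc {i : Fin (n - 1)} {j : Fin n} (h1 : j ≠ fa i) (h2 : j ≠ fb i) :
      Rel n (Ws i * Wg j) (Wg j * Ws i)
  | tgc {i : Fin (n - 1)} {j : Fin n} (h1 : j ≠ fa i) (h2 : j ≠ fb i) :
      Rel n (Wt i * Wg j) (Wg j * Wt i)

/-- The singular twisted virtual braid monoid on `n` strands. -/
abbrev STVB (n : ℕ) := PresentedMonoid (Rel n)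

def mkS (n : ℕ) : FM n →* STVB n := PresentedMonoid.mk (Rel n)

def sigE (n : ℕ) (i : Fin (n - 1)) : STVB n := mkS n (Ws i)
def sigbE (n : ℕ) (i : Fin (n - 1)) : STVB n := mkS n (Wsb i)
def rhoE (n : ℕ) (i : Fin (n - 1)) : STVB n := mkS n (Wr i)
def tauE (n : ℕ) (i : Fin (n - 1)) : STVB n := mkS n (Wt i)
def gamE (n : ℕ) (j : Fin n) : STVB n := mkS n (Wg j)

/-- The transposition `(i, i+1)` in the symmetric group on `Fin n`. -/
def swp {n : ℕ} (i : Fin (n - 1)) : Equiv.Perm (Fin n) := Equiv.swap (fa i) (fb i)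

end SingTVB
namespace SingTVB

/-- ρ-generator word with a natural-number (0-based) index; junk value `1` out of range. -/
def WrN (n : ℕ) (k : ℕ) : FM n := if h : k < n - 1 then Wr ⟨k, h⟩ else 1
def WsN (n : ℕ) (k : ℕ) : FM n := if h : k < n - 1 then Ws ⟨k, h⟩ else 1
def WsbN (n : ℕ) (k : ℕ) : FM n := if h : k < n - 1 then Wsb ⟨k, h⟩ else 1
def WtN (n : ℕ) (k : ℕ) : FM n := if h : k < n - 1 then Wt ⟨k, h⟩ else 1

/-- The ascending word `ρ_{i+1} ρ_{i+2} ⋯ ρ_{j-1}` (0-based strand indices `i < j`). -/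
def asc (n i j : ℕ) : FM n := ((List.range' (i + 1) (j - 1 - i)).map (WrN n)).prod
/-- The descending word `ρ_{j-1} ρ_{j-2} ⋯ ρ_{i+1}` (0-based strand indices `i < j`). -/
def desc (n i j : ℕ) : FM n := ((List.range' (i + 1) (j - 1 - i)).reverse.map (WrN n)).prod

/-- The word for the generator `λ_{i,j}` (0-based strands `i ≠ j`), built from
`λ_{i,i+1} = ρ_i σ̄_i` and `λ_{i+1,i} = ρ_i λ_{i,i+1} ρ_i` by conjugation. -/
def lamW (n i j : ℕ) : FM n :=
  if i < j then desc n i j * (WrN n i * WsbN n i) * asc n i j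
  else desc n j i * (WrN n j * (WrN n j * WsbN n j) * WrN n j) * asc n j i

/-- The word for `λ̄_{i,j}`, built from `λ̄_{i,i+1} = σ_i ρ_i`. -/
def lamBarW (n i j : ℕ) : FM n :=
  if i < j then desc n i j * (WsN n i * WrN n i) * asc n i j
  else desc n j i * (WrN n j * (WsN n j * WrN n j) * WrN n j) * asc n j i

/-- The word for `y_{i,j}`, built from `y_{i,i+1} = τ_i ρ_i`. -/
def yW (n i j : ℕ) : FM n :=
  if i < j then desc n i j * (WtN n i * WrN n i) * asc n i j
  else desc n j i * (WrN n j * (WtN n j * WrN n j) * WrN n j) * asc n j i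

/-- The word for `x_{i,j}`, built from `x_{i,i+1} = σ_i` and `x_{i+1,i} = ρ_i σ_i ρ_i`. -/
def xW (n i j : ℕ) : FM n :=
  if i < j then desc n i j * WsN n i * asc n i j
  else desc n j i * (WrN n j * WsN n j * WrN n j) * asc n j i

/-- The word for `x̄_{i,j}`, with `σ̄` in place of `σ`. -/
def xBarW (n i j : ℕ) : FM n :=
  if i < j then desc n i j * WsbN n i * asc n i j
  else desc n j i * (WrN n j * WsbN n j * WrN n j) * asc n j i

/-- The word for `z_{i,j}`, built from `z_{i,i+1} = τ_i` and `z_{i+1,i} = ρ_i τ_i ρ_i`. -/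
def zW (n i j : ℕ) : FM n :=
  if i < j then desc n i j * WtN n i * asc n i j
  else desc n j i * (WrN n j * WtN n j * WrN n j) * asc n j i

def lam (n : ℕ) (i j : Fin n) : STVB n := mkS n (lamW n i j)
def lamBar (n : ℕ) (i j : Fin n) : STVB n := mkS n (lamBarW n i j)
def yel (n : ℕ) (i j : Fin n) : STVB n := mkS n (yW n i j)
def xel (n : ℕ) (i j : Fin n) : STVB n := mkS n (xW n i j)
def xBar (n : ℕ) (i j : Fin n) : STVB n := mkS n (xBarW n i j)
def zel (n : ℕ) (i j : Fin n) : STVB n := mkS n (zW n i j)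

end SingTVB
namespace SingTVH

/-- Generators of the abstract presentation `H n` of `STVH n`: `u k l`, `ū k l`, `w k l`
for `k ≠ l` and `c j`. -/
inductive HGen (n : ℕ) : Type
  | u (k l : Fin n) (h : k ≠ l) : HGen n
  | ub (k l : Fin n) (h : k ≠ l) : HGen n
  | w (k l : Fin n) (h : k ≠ l) : HGen n
  | c (j : Fin n) : HGen n

abbrev FH (n : ℕ) := FreeMonoid (HGen n)

def wu {n : ℕ} (k l : Fin n) (h : k ≠ l) : FH n := FreeMonoid.of (HGen.u k l h)
def wub {n : ℕ} (k l : Fin n) (h : k ≠ l) : FH n := FreeMonoid.of (HGen.ub k l h)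
def ww {n : ℕ} (k l : Fin n) (h : k ≠ l) : FH n := FreeMonoid.of (HGen.w k l h)
def wc {n : ℕ} (j : Fin n) : FH n := FreeMonoid.of (HGen.c j)

/-- Defining relations of `H n`; within each relation distinct letters denote pairwise
distinct indices. -/
inductive HRel (n : ℕ) : FH n → FH n → Prop
  | c2 (j : Fin n) : HRel n (wc j * wc j) 1
  | cc {i j : Fin n} (h : i ≠ j) : HRel n (wc i * wc j) (wc j * wc i)
  | uInv {i j : Fin n} (h : i ≠ j) : HRel n (wu i j h * wub i j h) 1
  | uInv' {i j : Fin n} (h : i ≠ j) : HRel n (wub i j h * wu i j h) 1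
  | uu {i j k l : Fin n} (hij : i ≠ j) (hkl : k ≠ l)
      (hik : i ≠ k) (hil : i ≠ l) (hjk : j ≠ k) (hjl : j ≠ l) :
      HRel n (wu i j hij * wu k l hkl) (wu k l hkl * wu i j hij)
  | uuu {i j k : Fin n} (hik : i ≠ k) (hkj : k ≠ j) (hij : i ≠ j) :
      HRel n (wu i k hik * wu k j hkj * wu i k hik) (wu k j hkj * wu i k hik * wu k j hkj)
  | uc {i j k : Fin n} (hij : i ≠ j) (hki : k ≠ i) (hkj : k ≠ j) :
      HRel n (wu i j hij * wc k) (wc k * wu i j hij)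
  | uSym {i j : Fin n} (hij : i ≠ j) :
      HRel n (wu i j hij) (wc i * wc j * wu j i hij.symm * wc j * wc i)
  | uw {i j k l : Fin n} (hij : i ≠ j) (hkl : k ≠ l)
      (hik : i ≠ k) (hil : i ≠ l) (hjk : j ≠ k) (hjl : j ≠ l) :
      HRel n (wu i j hij * ww k l hkl) (ww k l hkl * wu i j hij)
  | uuw {i j k : Fin n} (hik : i ≠ k) (hkj : k ≠ j) (hij : i ≠ j) :
      HRel n (wu i k hik * wu k j hkj * ww i k hik) (ww k j hkj * wu i k hik * wu k j hkj)
  | wuu {i j k : Fin n} (hik : i ≠ k) (hkj : k ≠ j) (hij : i ≠ j) :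
      HRel n (ww i k hik * wu k j hkj * wu i k hik) (wu k j hkj * wu i k hik * ww k j hkj)
  | uwSame {i j : Fin n} (hij : i ≠ j) :
      HRel n (wu i j hij * ww i j hij) (ww i j hij * wu i j hij)
  | wwmul {i j k l : Fin n} (hij : i ≠ j) (hkl : k ≠ l)
      (hik : i ≠ k) (hil : i ≠ l) (hjk : j ≠ k) (hjl : j ≠ l) :
      HRel n (ww i j hij * ww k l hkl) (ww k l hkl * ww i j hij)
  | wcrel {i j k : Fin n} (hij : i ≠ j) (hki : k ≠ i) (hkj : k ≠ j) :
      HRel n (ww i j hij * wc k) (wc k * ww i j hij)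
  | wSym {i j : Fin n} (hij : i ≠ j) :
      HRel n (ww i j hij) (wc i * wc j * ww j i hij.symm * wc j * wc i)

/-- The abstractly presented monoid `H n`. -/
abbrev HM (n : ℕ) := PresentedMonoid (HRel n)

def mkH (n : ℕ) : FH n →* HM n := PresentedMonoid.mk (HRel n)

end SingTVH

section CoxeterTypeA

/-- The first `N` terms of `r` satisfy the Coxeter relations of the symmetric group on `N + 1`
letters. -/
structure IsCoxeterTypeA {U : Type*} [Monoid U] (r : ℕ → U) (N : ℕ) : Prop where
  sq : ∀ i, i < N → r i * r i = 1
  comm : ∀ i j, i + 1 < j → j < N → r i * r j = r j * r i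
  braid : ∀ i, i + 1 < N → r i * r (i + 1) * r i = r (i + 1) * r i * r (i + 1)

/-- The descending product `r (M - 1) * r (M - 2) * ⋯ * r k`. -/
def descProd {U : Type*} [Monoid U] (r : ℕ → U) : ℕ → ℕ → U
  | 0, _ => 1
  | M + 1, k => if k ≤ M then r M * descProd r M k else 1

section Monoid

variable {U : Type*} [Monoid U] {r : ℕ → U} {N : ℕ}

theorem descProd_of_le {M k : ℕ} (h : M ≤ k) : descProd r M k = 1 := by
  cases M with
  | zero => rfl
  | succ M => rw [descProd, if_neg (by omega)]

theorem descProd_succ {M k : ℕ} (h : k ≤ M) : descProd r (M + 1) k = r M * descProd r M k := by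
  rw [descProd, if_pos h]

theorem descProd_eq_mul {M k : ℕ} (h : k < M) :
    descProd r M k = descProd r M (k + 1) * r k := by
  induction M, Nat.succ_le_of_lt h using Nat.le_induction with
  | base =>
    rw [descProd_succ le_rfl, descProd_of_le le_rfl, descProd_of_le le_rfl, mul_one, one_mul]
  | succ M hM ih =>
    rw [descProd_succ (by omega), descProd_succ (by omega), ih (by omega), mul_assoc]

namespace IsCoxeterTypeA

theorem descProd_mul_self (hr : IsCoxeterTypeA r N) {M k : ℕ} (h : k < M) (hM : M ≤ N) :
    descProd r M k * r k = descProd r M (k + 1) := by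
  rw [descProd_eq_mul h, mul_assoc, hr.sq k (by omega), mul_one]

theorem comm_of_far (hr : IsCoxeterTypeA r N) {i j : ℕ} (h : i + 1 < j ∨ j + 1 < i)
    (hi : i < N) (hj : j < N) : r i * r j = r j * r i := by
  rcases h with h | h
  · exact hr.comm i j h hj
  · exact (hr.comm j i h hi).symm

theorem comm_descProd_of_lt (hr : IsCoxeterTypeA r N) {M k j : ℕ} (h : j + 1 < k) (hM : M ≤ N) :
    r j * descProd r M k = descProd r M k * r j := by
  induction M with
  | zero => simp [descProd]
  | succ M ih =>
    by_cases hk : k ≤ M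
    · rw [descProd_succ hk, ← mul_assoc, hr.comm j M (by omega) (by omega), mul_assoc,
        ih (by omega), mul_assoc]
    · rw [descProd_of_le (by omega), mul_one, one_mul]

theorem comm_descProd_of_gt (hr : IsCoxeterTypeA r N) {M k j : ℕ} (h : M < j) (hj : j < N) :
    r j * descProd r M k = descProd r M k * r j := by
  induction M with
  | zero => simp [descProd]
  | succ M ih =>
    by_cases hk : k ≤ M
    · rw [descProd_succ hk, ← mul_assoc, ← hr.comm M j (by omega) (by omega), mul_assoc,
        ih (by omega), mul_assoc]
    · rw [descProd_of_le (by omega), mul_one, one_mul]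

theorem mul_descProd_of_between (hr : IsCoxeterTypeA r N) {M k j : ℕ} (hkj : k ≤ j)
    (hj : j + 1 < M) (hM : M ≤ N) :
    r j * descProd r M k = descProd r M k * r (j + 1) := by
  induction M with
  | zero => omega
  | succ M ih =>
    rcases Nat.lt_or_ge (j + 1) M with h | h
    · rw [descProd_succ (by omega), ← mul_assoc, hr.comm j M h (by omega), mul_assoc,
        ih h (by omega), mul_assoc]
    · obtain rfl : M = j + 1 := by omega
      rw [descProd_succ (by omega), descProd_succ hkj, mul_assoc, mul_assoc,
        ← hr.comm_descProd_of_gt (Nat.lt_succ_self j) (by omega), ← mul_assoc, ← mul_assoc,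
        ← mul_assoc, ← mul_assoc, hr.braid j (by omega)]

theorem exists_mul_descProd (hr : IsCoxeterTypeA r N) {M : ℕ} (hM : M < N) {g : U}
    (hg : g ∈ Submonoid.closure (r '' Set.Iio (M + 1))) :
    ∃ w ∈ Submonoid.closure (r '' Set.Iio M), ∃ k ≤ M + 1, g = w * descProd r (M + 1) k := by
  have mem (i : ℕ) (hi : i < M) : r i ∈ Submonoid.closure (r '' Set.Iio M) :=
    Submonoid.subset_closure ⟨i, hi, rfl⟩
  induction hg using Submonoid.closure_induction_right with
  | one => exact ⟨1, one_mem _, M + 1, le_rfl, by rw [descProd_of_le le_rfl, mul_one]⟩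
  | mul_right g _ y hy ih =>
    obtain ⟨j, hj, rfl⟩ := hy
    obtain ⟨w, hw, k, hk, rfl⟩ := ih
    have hj : j < M + 1 := hj
    rcases lt_trichotomy j k with h | rfl | h
    · rcases Nat.lt_or_ge (j + 1) k with h' | h'
      · exact ⟨w * r j, mul_mem hw (mem j (by omega)), k, hk, by
          rw [mul_assoc, mul_assoc, hr.comm_descProd_of_lt h' (by omega)]⟩
      · obtain rfl : k = j + 1 := by omega
        exact ⟨w, hw, j, by omega, by rw [mul_assoc, ← descProd_eq_mul (by omega)]⟩
    · exact ⟨w, hw, j + 1, by omega, by rw [mul_assoc, hr.descProd_mul_self hj (by omega)]⟩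
    · obtain ⟨i, rfl⟩ : ∃ i, j = i + 1 := ⟨j - 1, by omega⟩
      exact ⟨w * r i, mul_mem hw (mem i (by omega)), k, hk, by
        rw [mul_assoc, mul_assoc, hr.mul_descProd_of_between (by omega) (by omega) (by omega)]⟩

/-- The Coxeter relations of type `A` present the symmetric group: a product of the generators
acting trivially on `{0, …, N}` is trivial. -/
theorem eq_one_of_mem_closure (hr : IsCoxeterTypeA r N) (f : U →* Equiv.Perm ℕ)
    (hf : ∀ i, i < N → f (r i) = Equiv.swap i (i + 1)) {M : ℕ} (hM : M ≤ N) {g : U}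
    (hg : g ∈ Submonoid.closure (r '' Set.Iio M)) (h1 : f g = 1) : g = 1 := by
  have fix (M : ℕ) (hM : M ≤ N) (g : U) (hg : g ∈ Submonoid.closure (r '' Set.Iio M)) :
      f g (M + 1) = M + 1 := by
    induction hg using Submonoid.closure_induction with
    | mem x hx =>
      obtain ⟨i, hi, rfl⟩ := hx
      have hi : i < M := hi
      rw [hf i (by omega), Equiv.swap_apply_of_ne_of_ne (by omega) (by omega)]
    | one => simp
    | mul x y _ _ hx hy => rw [map_mul, Equiv.Perm.mul_apply, hy, hx]
  have shift (M k : ℕ) (hk : k ≤ M) (hM : M ≤ N) : f (descProd r M k) k = M := by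
    induction M, hk using Nat.le_induction with
    | base => rw [descProd_of_le le_rfl, map_one, Equiv.Perm.one_apply]
    | succ M hkM ih =>
      rw [descProd_succ hkM, map_mul, Equiv.Perm.mul_apply, ih (by omega), hf M (by omega),
        Equiv.swap_apply_left]
  induction M generalizing g with
  | zero =>
    have : Set.Iio 0 = (∅ : Set ℕ) := by ext; simp
    simpa [this] using hg
  | succ M ih =>
    obtain ⟨w, hw, k, hk, rfl⟩ := hr.exists_mul_descProd (by omega) hg
    have hk' : k = M + 1 := by
      have := congrArg (fun e : Equiv.Perm ℕ => e k) h1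
      simp only [map_mul, Equiv.Perm.mul_apply, shift (M + 1) k hk (by omega),
        fix M (by omega) w hw, Equiv.Perm.one_apply] at this
      exact this.symm
    rw [descProd_of_le hk'.ge, mul_one] at h1 ⊢
    exact ih (by omega) hw h1

end IsCoxeterTypeA

end Monoid

section Action

variable {U X : Type*} [Group U] [MulAction U X] {r : ℕ → U} {N : ℕ}

/-- The first `N` terms of `s` behave under the action of `r` like objects supported on the
strands `i` and `i + 1`. -/
structure IsLocalFamily (r : ℕ → U) (s : ℕ → X) (N : ℕ) : Prop where
  far : ∀ i j, i < N → j < N → (i + 1 < j ∨ j + 1 < i) → r j • s i = s i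
  slide : ∀ i, i + 1 < N → r i • s (i + 1) = r (i + 1) • s i

/-- The family indexed by pairs of strands that is obtained by transporting `s i`, placed on
`(i, i + 1)`, along `r`. -/
def pairFamily (r : ℕ → U) (s : ℕ → X) (k l : ℕ) : X :=
  if k < l then descProd r l (k + 1) • s k else descProd r k (l + 1) • r l • s l

theorem pairFamily_succ (r : ℕ → U) (s : ℕ → X) (k : ℕ) : pairFamily r s k (k + 1) = s k := by
  rw [pairFamily, if_pos (Nat.lt_succ_self k), descProd_of_le le_rfl, one_smul]

theorem IsLocalFamily.flip {s : ℕ → X} (hr : IsCoxeterTypeA r N) (hs : IsLocalFamily r s N) :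
    IsLocalFamily r (fun i => r i • s i) N where
  far i j hi hj h := by
    rw [← mul_smul, hr.comm_of_far h.symm hj hi, mul_smul, hs.far i j hi hj h]
  slide i hi := by
    have h : s (i + 1) = r i • r (i + 1) • s i := by
      rw [← hs.slide i hi, ← mul_smul, hr.sq i (by omega), one_smul]
    simp only [h, ← mul_smul]
    rw [← mul_assoc (r (i + 1)), ← hr.braid i hi, ← mul_assoc, ← mul_assoc, hr.sq i (by omega),
      one_mul]

theorem IsLocalFamily.smul_descProd {s : ℕ → X} (hr : IsCoxeterTypeA r N)
    (hs : IsLocalFamily r s N) {k l m : ℕ} (hkl : k < l) (hl : l ≤ N) (hm : m < N)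
    (h : ¬(k = m ∧ l = m + 1)) :
    Equiv.swap m (m + 1) k < Equiv.swap m (m + 1) l ∧
      r m • descProd r l (k + 1) • s k =
        descProd r (Equiv.swap m (m + 1) l) (Equiv.swap m (m + 1) k + 1) •
          s (Equiv.swap m (m + 1) k) := by
  have fixed {i : ℕ} (h1 : i ≠ m) (h2 : i ≠ m + 1) : Equiv.swap m (m + 1) i = i :=
    Equiv.swap_apply_of_ne_of_ne h1 h2
  by_cases hkm : k = m
  · subst hkm
    rw [Equiv.swap_apply_left, fixed (by omega) (by omega)]
    refine ⟨by omega, ?_⟩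
    rw [descProd_eq_mul (by omega), ← mul_smul, ← mul_assoc,
      hr.comm_descProd_of_lt (by omega) hl, mul_smul, mul_smul, ← hs.slide k (by omega),
      ← mul_smul (r k), hr.sq k hm, one_smul]
  by_cases hkm1 : k = m + 1
  · subst hkm1
    rw [Equiv.swap_apply_right, fixed (by omega) (by omega)]
    refine ⟨by omega, ?_⟩
    rw [← mul_smul, hr.comm_descProd_of_lt (by omega) hl, mul_smul, hs.slide m (by omega),
      ← mul_smul, ← descProd_eq_mul (by omega)]
  rw [fixed hkm hkm1]
  by_cases hlm : l = m
  · subst hlm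
    rw [Equiv.swap_apply_left]
    exact ⟨by omega, by rw [← mul_smul, descProd_succ (by omega)]⟩
  by_cases hlm1 : l = m + 1
  · subst hlm1
    rw [Equiv.swap_apply_right]
    exact ⟨by omega, by
      rw [descProd_succ (by omega), ← mul_smul, ← mul_assoc, hr.sq m hm, one_mul]⟩
  rw [fixed hlm hlm1]
  refine ⟨hkl, ?_⟩
  rcases Nat.lt_or_ge m k with h1 | h1
  · rw [← mul_smul, hr.comm_descProd_of_lt (by omega) hl, mul_smul,
      hs.far k m (by omega) hm (by omega)]
  rcases Nat.lt_or_ge l m with h2 | h2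
  · rw [← mul_smul, hr.comm_descProd_of_gt h2 hm, mul_smul, hs.far k m (by omega) hm (by omega)]
  · rw [← mul_smul, hr.mul_descProd_of_between (by omega) (by omega) hl, mul_smul,
      hs.far k (m + 1) (by omega) (by omega) (by omega)]

theorem IsLocalFamily.smul_pairFamily {s : ℕ → X} (hr : IsCoxeterTypeA r N)
    (hs : IsLocalFamily r s N) {k l m : ℕ} (hkl : k ≠ l) (hk : k ≤ N) (hl : l ≤ N) (hm : m < N) :
    r m • pairFamily r s k l =
      pairFamily r s (Equiv.swap m (m + 1) k) (Equiv.swap m (m + 1) l) := by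
  rcases lt_or_gt_of_ne hkl with h | h
  · rw [pairFamily, if_pos h]
    by_cases hc : k = m ∧ l = m + 1
    · obtain ⟨rfl, rfl⟩ := hc
      rw [Equiv.swap_apply_left, Equiv.swap_apply_right, pairFamily, if_neg (by omega),
        descProd_of_le le_rfl, one_smul, one_smul]
    · obtain ⟨h1, h2⟩ := hs.smul_descProd hr h hl hm hc
      rw [pairFamily, if_pos h1, h2]
  · rw [pairFamily, if_neg (by omega)]
    by_cases hc : l = m ∧ k = m + 1
    · obtain ⟨rfl, rfl⟩ := hc
      rw [Equiv.swap_apply_left, Equiv.swap_apply_right, pairFamily_succ, descProd_of_le le_rfl,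
        one_smul, ← mul_smul, hr.sq l hm, one_smul]
    · obtain ⟨h1, h2⟩ := (hs.flip hr).smul_descProd hr h hk hm hc
      rw [pairFamily, if_neg (by omega), h2]

end Action

end CoxeterTypeA

namespace SingTVB

variable {n : ℕ}

@[simp] theorem val_fa (i : Fin (n - 1)) : (fa i).val = i.val := rfl
@[simp] theorem val_fb (i : Fin (n - 1)) : (fb i).val = i.val + 1 := rfl

theorem fa_ne_fb (i : Fin (n - 1)) : fa i ≠ fb i := Fin.ne_of_val_ne (by simp)

theorem fa_eq_fb {i j : Fin (n - 1)} (h : j.val = i.val + 1) : fa j = fb i := Fin.ext h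

theorem fa_ne_fb_of_succ {i j : Fin (n - 1)} (h : j.val = i.val + 1) : fa i ≠ fb j :=
  Fin.ne_of_val_ne (by simp; omega)

theorem Far.ne {i j : Fin (n - 1)} (h : Far i j) :
    fa i ≠ fa j ∧ fa i ≠ fb j ∧ fb i ≠ fa j ∧ fb i ≠ fb j := by
  simp only [Far, ne_eq, Fin.ext_iff, val_fa, val_fb] at *
  omega

@[simp] theorem swp_fa (i : Fin (n - 1)) : swp i (fa i) = fb i := Equiv.swap_apply_left _ _
@[simp] theorem swp_fb (i : Fin (n - 1)) : swp i (fb i) = fa i := Equiv.swap_apply_right _ _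

theorem swp_of_ne {i : Fin (n - 1)} {j : Fin n} (h1 : j ≠ fa i) (h2 : j ≠ fb i) : swp i j = j :=
  Equiv.swap_apply_of_ne_of_ne h1 h2

theorem val_swp (i : Fin (n - 1)) (k : Fin n) :
    (swp i k).val = Equiv.swap i.val (i.val + 1) k.val := by
  simp only [swp, Equiv.swap_apply_def, Fin.ext_iff, val_fa, val_fb]
  split_ifs <;> rfl

theorem swp_mul_self (i : Fin (n - 1)) : swp i * swp i = 1 := Equiv.swap_mul_self _ _

theorem swp_comm {i j : Fin (n - 1)} (h : Far i j) : swp i * swp j = swp j * swp i := by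
  ext k
  simp only [Far, Equiv.Perm.mul_apply, val_swp, Equiv.swap_apply_def] at *
  split_ifs <;> omega

theorem swp_braid {i j : Fin (n - 1)} (h : j.val = i.val + 1) :
    swp i * swp j * swp i = swp j * swp i * swp j := by
  ext k
  simp only [Equiv.Perm.mul_apply, val_swp, Equiv.swap_apply_def, h]
  split_ifs <;> omega

theorem closure_swp (n : ℕ) : Submonoid.closure (Set.range (swp (n := n))) = ⊤ := by
  cases n with
  | zero => exact Subsingleton.elim _ _
  | succ m => exact Equiv.Perm.mclosure_swap_castSucc_succ m

end SingTVB

namespace SingTVH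

variable {n : ℕ}

/-- A family of elements of a monoid satisfying the defining relations of `HM n`. -/
structure IsHFamily {M : Type*} [Monoid M] (u ub w : Fin n → Fin n → M) (c : Fin n → M) :
    Prop where
  c2 (j) : c j * c j = 1
  cc (i j) : i ≠ j → c i * c j = c j * c i
  uInv (i j) : i ≠ j → u i j * ub i j = 1
  uInv' (i j) : i ≠ j → ub i j * u i j = 1
  uu (i j k l) : i ≠ j → k ≠ l → i ≠ k → i ≠ l → j ≠ k → j ≠ l → u i j * u k l = u k l * u i j
  uuu (i j k) : i ≠ k → k ≠ j → i ≠ j → u i k * u k j * u i k = u k j * u i k * u k j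
  uc (i j k) : i ≠ j → k ≠ i → k ≠ j → u i j * c k = c k * u i j
  uSym (i j) : i ≠ j → u i j = c i * c j * u j i * c j * c i
  uw (i j k l) : i ≠ j → k ≠ l → i ≠ k → i ≠ l → j ≠ k → j ≠ l → u i j * w k l = w k l * u i j
  uuw (i j k) : i ≠ k → k ≠ j → i ≠ j → u i k * u k j * w i k = w k j * u i k * u k j
  wuu (i j k) : i ≠ k → k ≠ j → i ≠ j → w i k * u k j * u i k = u k j * u i k * w k j
  uwSame (i j) : i ≠ j → u i j * w i j = w i j * u i j
  ww (i j k l) : i ≠ j → k ≠ l → i ≠ k → i ≠ l → j ≠ k → j ≠ l → w i j * w k l = w k l * w i j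
  wc (i j k) : i ≠ j → k ≠ i → k ≠ j → w i j * c k = c k * w i j
  wSym (i j) : i ≠ j → w i j = c i * c j * w j i * c j * c i

/-- The class of `u k l` in `HM n`, with junk value `1` for `k = l`. -/
def uH (k l : Fin n) : HM n := if h : k ≠ l then mkH n (wu k l h) else 1
/-- The class of `ū k l` in `HM n`, with junk value `1` for `k = l`. -/
def ubH (k l : Fin n) : HM n := if h : k ≠ l then mkH n (wub k l h) else 1
/-- The class of `w k l` in `HM n`, with junk value `1` for `k = l`. -/
def wH (k l : Fin n) : HM n := if h : k ≠ l then mkH n (ww k l h) else 1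
/-- The class of `c j` in `HM n`. -/
def cH (j : Fin n) : HM n := mkH n (wc j)

theorem uH_of_ne {k l : Fin n} (h : k ≠ l) : uH k l = mkH n (wu k l h) := dif_pos h
theorem ubH_of_ne {k l : Fin n} (h : k ≠ l) : ubH k l = mkH n (wub k l h) := dif_pos h
theorem wH_of_ne {k l : Fin n} (h : k ≠ l) : wH k l = mkH n (ww k l h) := dif_pos h

theorem mkH_eq_of_rel {a b : FH n} (h : HRel n a b) : mkH n a = mkH n b :=
  PresentedMonoid.mk_eq_mk_of_rel h

theorem isHFamily_HM (n : ℕ) : IsHFamily (uH (n := n)) ubH wH cH where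
  c2 j := mkH_eq_of_rel (.c2 j)
  cc _ _ h := mkH_eq_of_rel (.cc h)
  uInv _ _ h := by rw [uH_of_ne h, ubH_of_ne h]; exact mkH_eq_of_rel (.uInv h)
  uInv' _ _ h := by rw [uH_of_ne h, ubH_of_ne h]; exact mkH_eq_of_rel (.uInv' h)
  uu _ _ _ _ h h' h1 h2 h3 h4 := by
    rw [uH_of_ne h, uH_of_ne h']; exact mkH_eq_of_rel (.uu h h' h1 h2 h3 h4)
  uuu _ _ _ h1 h2 h3 := by
    rw [uH_of_ne h1, uH_of_ne h2]; exact mkH_eq_of_rel (.uuu h1 h2 h3)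
  uc _ _ _ h h1 h2 := by rw [uH_of_ne h]; exact mkH_eq_of_rel (.uc h h1 h2)
  uSym _ _ h := by rw [uH_of_ne h, uH_of_ne h.symm]; exact mkH_eq_of_rel (.uSym h)
  uw _ _ _ _ h h' h1 h2 h3 h4 := by
    rw [uH_of_ne h, wH_of_ne h']; exact mkH_eq_of_rel (.uw h h' h1 h2 h3 h4)
  uuw _ _ _ h1 h2 h3 := by
    rw [uH_of_ne h1, uH_of_ne h2, wH_of_ne h1, wH_of_ne h2]
    exact mkH_eq_of_rel (.uuw h1 h2 h3)
  wuu _ _ _ h1 h2 h3 := by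
    rw [uH_of_ne h1, uH_of_ne h2, wH_of_ne h1, wH_of_ne h2]
    exact mkH_eq_of_rel (.wuu h1 h2 h3)
  uwSame _ _ h := by rw [uH_of_ne h, wH_of_ne h]; exact mkH_eq_of_rel (.uwSame h)
  ww _ _ _ _ h h' h1 h2 h3 h4 := by
    rw [wH_of_ne h, wH_of_ne h']; exact mkH_eq_of_rel (.wwmul h h' h1 h2 h3 h4)
  wc _ _ _ h h1 h2 := by rw [wH_of_ne h]; exact mkH_eq_of_rel (.wcrel h h1 h2)
  wSym _ _ h := by rw [wH_of_ne h, wH_of_ne h.symm]; exact mkH_eq_of_rel (.wSym h)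

namespace IsHFamily

variable {M : Type*} [Monoid M] {u ub w : Fin n → Fin n → M} {c : Fin n → M}

theorem perm (H : IsHFamily u ub w c) (p : Equiv.Perm (Fin n)) :
    IsHFamily (fun k l => u (p k) (p l)) (fun k l => ub (p k) (p l)) (fun k l => w (p k) (p l))
      (fun j => c (p j)) := by
  have hp {a b : Fin n} (h : a ≠ b) : p a ≠ p b := p.injective.ne h
  exact
    { c2 := fun j => H.c2 _
      cc := fun _ _ h => H.cc _ _ (hp h)
      uInv := fun _ _ h => H.uInv _ _ (hp h)
      uInv' := fun _ _ h => H.uInv' _ _ (hp h)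
      uu := fun _ _ _ _ h h' h1 h2 h3 h4 =>
        H.uu _ _ _ _ (hp h) (hp h') (hp h1) (hp h2) (hp h3) (hp h4)
      uuu := fun _ _ _ h1 h2 h3 => H.uuu _ _ _ (hp h1) (hp h2) (hp h3)
      uc := fun _ _ _ h1 h2 h3 => H.uc _ _ _ (hp h1) (hp h2) (hp h3)
      uSym := fun _ _ h => H.uSym _ _ (hp h)
      uw := fun _ _ _ _ h h' h1 h2 h3 h4 =>
        H.uw _ _ _ _ (hp h) (hp h') (hp h1) (hp h2) (hp h3) (hp h4)
      uuw := fun _ _ _ h1 h2 h3 => H.uuw _ _ _ (hp h1) (hp h2) (hp h3)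
      wuu := fun _ _ _ h1 h2 h3 => H.wuu _ _ _ (hp h1) (hp h2) (hp h3)
      uwSame := fun _ _ h => H.uwSame _ _ (hp h)
      ww := fun _ _ _ _ h h' h1 h2 h3 h4 =>
        H.ww _ _ _ _ (hp h) (hp h') (hp h1) (hp h2) (hp h3) (hp h4)
      wc := fun _ _ _ h1 h2 h3 => H.wc _ _ _ (hp h1) (hp h2) (hp h3)
      wSym := fun _ _ h => H.wSym _ _ (hp h) }

/-- The homomorphism out of `HM n` determined by a family satisfying its relations. -/
def lift (H : IsHFamily u ub w c) : HM n →* M :=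
  PresentedMonoid.lift
    (fun
      | .u k l _ => u k l
      | .ub k l _ => ub k l
      | .w k l _ => w k l
      | .c j => c j)
    (by
      intro a b hab
      cases hab <;>
        simp only [wu, wub, SingTVH.ww, SingTVH.wc, map_mul, map_one, FreeMonoid.lift_eval_of]
      case c2 j => exact H.c2 j
      case cc h => exact H.cc _ _ h
      case uInv h => exact H.uInv _ _ h
      case uInv' h => exact H.uInv' _ _ h
      case uu h h' h1 h2 h3 h4 => exact H.uu _ _ _ _ h h' h1 h2 h3 h4
      case uuu h1 h2 h3 => exact H.uuu _ _ _ h1 h2 h3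
      case uc h1 h2 h3 => exact H.uc _ _ _ h1 h2 h3
      case uSym h => exact H.uSym _ _ h
      case uw h h' h1 h2 h3 h4 => exact H.uw _ _ _ _ h h' h1 h2 h3 h4
      case uuw h1 h2 h3 => exact H.uuw _ _ _ h1 h2 h3
      case wuu h1 h2 h3 => exact H.wuu _ _ _ h1 h2 h3
      case uwSame h => exact H.uwSame _ _ h
      case wwmul h h' h1 h2 h3 h4 => exact H.ww _ _ _ _ h h' h1 h2 h3 h4
      case wcrel h1 h2 h3 => exact H.wc _ _ _ h1 h2 h3
      case wSym h => exact H.wSym _ _ h)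

theorem lift_u (H : IsHFamily u ub w c) {k l : Fin n} (h : k ≠ l) : H.lift (uH k l) = u k l := by
  rw [uH_of_ne h]; rfl

theorem lift_ub (H : IsHFamily u ub w c) {k l : Fin n} (h : k ≠ l) :
    H.lift (ubH k l) = ub k l := by
  rw [ubH_of_ne h]; rfl

theorem lift_w (H : IsHFamily u ub w c) {k l : Fin n} (h : k ≠ l) : H.lift (wH k l) = w k l := by
  rw [wH_of_ne h]; rfl

end IsHFamily

theorem HM.hom_ext {M : Type*} [Monoid M] {f g : HM n →* M}
    (hu : ∀ k l, k ≠ l → f (uH k l) = g (uH k l))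
    (hub : ∀ k l, k ≠ l → f (ubH k l) = g (ubH k l))
    (hw : ∀ k l, k ≠ l → f (wH k l) = g (wH k l))
    (hc : ∀ j, f (cH j) = g (cH j)) : f = g := by
  refine PresentedMonoid.ext _ fun x => ?_
  cases x with
  | u k l h => have := hu k l h; rwa [uH_of_ne h] at this
  | ub k l h => have := hub k l h; rwa [ubH_of_ne h] at this
  | w k l h => have := hw k l h; rwa [wH_of_ne h] at this
  | c j => exact hc j

/-- The action of a permutation of the strands on `HM n`. -/
def relabel (p : Equiv.Perm (Fin n)) : HM n →* HM n := ((isHFamily_HM n).perm p).lift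

section relabel

variable (p q : Equiv.Perm (Fin n))

theorem relabel_u {k l : Fin n} (h : k ≠ l) : relabel p (uH k l) = uH (p k) (p l) :=
  IsHFamily.lift_u _ h

theorem relabel_ub {k l : Fin n} (h : k ≠ l) : relabel p (ubH k l) = ubH (p k) (p l) :=
  IsHFamily.lift_ub _ h

theorem relabel_w {k l : Fin n} (h : k ≠ l) : relabel p (wH k l) = wH (p k) (p l) :=
  IsHFamily.lift_w _ h

@[simp] theorem relabel_c (j : Fin n) : relabel p (cH j) = cH (p j) := rfl

theorem relabel_one : relabel (1 : Equiv.Perm (Fin n)) = MonoidHom.id _ :=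
  HM.hom_ext (fun _ _ h => relabel_u 1 h) (fun _ _ h => relabel_ub 1 h)
    (fun _ _ h => relabel_w 1 h) (fun _ => rfl)

theorem relabel_mul : relabel (p * q) = (relabel p).comp (relabel q) := by
  refine HM.hom_ext (fun k l h => ?_) (fun k l h => ?_) (fun k l h => ?_) (fun _ => rfl)
  · simp [relabel_u, h]
  · simp [relabel_ub, h]
  · simp [relabel_w, h]

theorem relabel_relabel (x : HM n) : relabel p (relabel q x) = relabel (p * q) x := by
  rw [relabel_mul]; rfl

end relabel

end SingTVH

namespace SingTVB

variable {n : ℕ}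

theorem mkS_eq_of_rel {a b : FM n} (h : Rel n a b) : mkS n a = mkS n b :=
  PresentedMonoid.mk_eq_mk_of_rel h

theorem rhoE_mul_self (i : Fin (n - 1)) : rhoE n i * rhoE n i = 1 := mkS_eq_of_rel (.rho2 i)

/-- The generator `ρ_k` as a unit acting by conjugation; junk value `1` out of range. -/
def rhoC (n k : ℕ) : ConjAct (STVB n)ˣ :=
  if h : k < n - 1 then
    ConjAct.toConjAct ⟨rhoE n ⟨k, h⟩, rhoE n ⟨k, h⟩, rhoE_mul_self _, rhoE_mul_self _⟩
  else 1

/-- The element of `STVB n` by which `g` conjugates. -/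
def conjVal (g : ConjAct (STVB n)ˣ) : STVB n := ((ConjAct.ofConjAct g : (STVB n)ˣ) : STVB n)

@[simp] theorem conjVal_one : conjVal (1 : ConjAct (STVB n)ˣ) = 1 := rfl

@[simp] theorem conjVal_mul (g h : ConjAct (STVB n)ˣ) :
    conjVal (g * h) = conjVal g * conjVal h := rfl

theorem conjVal_mul_inv (g : ConjAct (STVB n)ˣ) : conjVal g * conjVal g⁻¹ = 1 := by
  rw [← conjVal_mul, mul_inv_cancel, conjVal_one]

theorem conjVal_injective : Function.Injective (conjVal (n := n)) := fun _ _ h => Units.ext h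

theorem smul_eq_conjVal (g : ConjAct (STVB n)ˣ) (x : STVB n) :
    g • x = conjVal g * x * conjVal g⁻¹ := rfl

theorem conjVal_mul_eq_smul (g : ConjAct (STVB n)ˣ) (x : STVB n) :
    conjVal g * x = (g • x) * conjVal g := by
  rw [smul_eq_conjVal, mul_assoc, ← conjVal_mul, inv_mul_cancel, conjVal_one, mul_one]

theorem conjVal_rhoC (i : Fin (n - 1)) : conjVal (rhoC n i) = rhoE n i := by
  rw [rhoC, dif_pos i.isLt]; rfl

theorem rhoC_smul (i : Fin (n - 1)) (x : STVB n) :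
    rhoC n i • x = rhoE n i * x * rhoE n i := by
  rw [rhoC, dif_pos i.isLt]; rfl

theorem isCoxeterTypeA_rhoC (n : ℕ) : IsCoxeterTypeA (rhoC n) (n - 1) where
  sq i hi := conjVal_injective (by
    have := conjVal_rhoC ⟨i, hi⟩
    simp only at this
    rw [conjVal_mul, this, rhoE_mul_self, conjVal_one])
  comm i j h hj := conjVal_injective (by
    have h1 := conjVal_rhoC (n := n) ⟨i, by omega⟩
    have h2 := conjVal_rhoC ⟨j, hj⟩
    simp only at h1 h2
    rw [conjVal_mul, conjVal_mul, h1, h2]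
    exact mkS_eq_of_rel (.rr (Or.inl h)))
  braid i hi := conjVal_injective (by
    have h1 := conjVal_rhoC (n := n) ⟨i, by omega⟩
    have h2 := conjVal_rhoC ⟨i + 1, hi⟩
    simp only at h1 h2
    simp only [conjVal_mul, h1, h2]
    exact mkS_eq_of_rel (.rrr rfl))

theorem rhoC_inv (n k : ℕ) : (rhoC n k)⁻¹ = rhoC n k := by
  by_cases h : k < n - 1
  · exact inv_eq_of_mul_eq_one_left ((isCoxeterTypeA_rhoC n).sq k h)
  · rw [rhoC, dif_neg h, inv_one]

theorem mkS_WrN (n k : ℕ) : mkS n (WrN n k) = conjVal (rhoC n k) := by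
  by_cases h : k < n - 1
  · rw [WrN, dif_pos h]; exact (conjVal_rhoC ⟨k, h⟩).symm
  · rw [WrN, dif_neg h, rhoC, dif_neg h]; rfl

theorem mkS_desc (n i j : ℕ) : mkS n (desc n i j) = conjVal (descProd (rhoC n) j (i + 1)) := by
  induction j with
  | zero => simp [desc, descProd]
  | succ j ih =>
    by_cases h : i + 1 ≤ j
    · have h1 : j + 1 - 1 - i = j - 1 - i + 1 := by omega
      have h2 : i + 1 + (j - 1 - i) = j := by omega
      rw [descProd_succ h, conjVal_mul, ← ih, desc, desc, h1, List.range'_1_concat, h2]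
      simp [mkS_WrN]
    · have h1 : j + 1 - 1 - i = 0 := by omega
      rw [descProd_of_le (by omega), desc, h1]
      simp

theorem mkS_asc (n i j : ℕ) : mkS n (asc n i j) = conjVal (descProd (rhoC n) j (i + 1))⁻¹ := by
  induction j with
  | zero => simp [asc, descProd]
  | succ j ih =>
    by_cases h : i + 1 ≤ j
    · have h1 : j + 1 - 1 - i = j - 1 - i + 1 := by omega
      have h2 : i + 1 + (j - 1 - i) = j := by omega
      rw [descProd_succ h, mul_inv_rev, conjVal_mul, ← ih, asc, asc, h1, List.range'_1_concat, h2]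
      simp [mkS_WrN, rhoC_inv]
    · have h1 : j + 1 - 1 - i = 0 := by omega
      rw [descProd_of_le (by omega), asc, h1]
      simp

theorem mkS_eq_pairFamily (W : ℕ → FM n) (i j : ℕ) :
    mkS n (if i < j then desc n i j * W i * asc n i j
      else desc n j i * (WrN n j * W j * WrN n j) * asc n j i) =
    pairFamily (rhoC n) (fun k => mkS n (W k)) i j := by
  rw [pairFamily]
  split_ifs
  · rw [map_mul, map_mul, mkS_desc, mkS_asc, smul_eq_conjVal]
  · rw [map_mul, map_mul, mkS_desc, mkS_asc, smul_eq_conjVal, map_mul, map_mul, mkS_WrN,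
      smul_eq_conjVal, rhoC_inv]

theorem xel_eq (k l : Fin n) : xel n k l = pairFamily (rhoC n) (fun i => mkS n (WsN n i)) k l :=
  mkS_eq_pairFamily _ _ _

theorem xBar_eq (k l : Fin n) : xBar n k l = pairFamily (rhoC n) (fun i => mkS n (WsbN n i)) k l :=
  mkS_eq_pairFamily _ _ _

theorem zel_eq (k l : Fin n) : zel n k l = pairFamily (rhoC n) (fun i => mkS n (WtN n i)) k l :=
  mkS_eq_pairFamily _ _ _

theorem mkS_WsN (i : Fin (n - 1)) : mkS n (WsN n i) = sigE n i := by
  rw [WsN, dif_pos i.isLt]; rfl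

theorem mkS_WsbN (i : Fin (n - 1)) : mkS n (WsbN n i) = sigbE n i := by
  rw [WsbN, dif_pos i.isLt]; rfl

theorem mkS_WtN (i : Fin (n - 1)) : mkS n (WtN n i) = tauE n i := by
  rw [WtN, dif_pos i.isLt]; rfl

theorem xel_fa_fb (i : Fin (n - 1)) : xel n (fa i) (fb i) = sigE n i := by
  rw [xel_eq, val_fa, val_fb, pairFamily_succ, mkS_WsN]

theorem xBar_fa_fb (i : Fin (n - 1)) : xBar n (fa i) (fb i) = sigbE n i := by
  rw [xBar_eq, val_fa, val_fb, pairFamily_succ, mkS_WsbN]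

theorem zel_fa_fb (i : Fin (n - 1)) : zel n (fa i) (fb i) = tauE n i := by
  rw [zel_eq, val_fa, val_fb, pairFamily_succ, mkS_WtN]

theorem isLocalFamily_of_fin {s : ℕ → STVB n}
    (far : ∀ i j : Fin (n - 1), Far i j → s i * rhoE n j = rhoE n j * s i)
    (slide : ∀ i j : Fin (n - 1), j.val = i.val + 1 →
      rhoE n i * s j * rhoE n i = rhoE n j * s i * rhoE n j) :
    IsLocalFamily (rhoC n) s (n - 1) where
  far i j hi hj h := by
    have := rhoC_smul ⟨j, hj⟩ (s i)
    rw [← far ⟨i, hi⟩ ⟨j, hj⟩ h, mul_assoc, rhoE_mul_self, mul_one] at this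
    exact this
  slide i hi := by
    have h1 := rhoC_smul (n := n) ⟨i, by omega⟩ (s (i + 1))
    have h2 := rhoC_smul ⟨i + 1, hi⟩ (s i)
    exact h1.trans ((slide ⟨i, by omega⟩ ⟨i + 1, hi⟩ rfl).trans h2.symm)

theorem isLocalFamily_sig (n : ℕ) :
    IsLocalFamily (rhoC n) (fun k => mkS n (WsN n k)) (n - 1) :=
  isLocalFamily_of_fin
    (fun i j h => by rw [mkS_WsN]; exact mkS_eq_of_rel (.sr h))
    (fun i j h => by rw [mkS_WsN, mkS_WsN]; exact mkS_eq_of_rel (.rsr h))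

theorem isLocalFamily_tau (n : ℕ) :
    IsLocalFamily (rhoC n) (fun k => mkS n (WtN n k)) (n - 1) :=
  isLocalFamily_of_fin
    (fun i j h => by rw [mkS_WtN]; exact mkS_eq_of_rel (.tr h))
    (fun i j h => by rw [mkS_WtN, mkS_WtN]; exact mkS_eq_of_rel (.rtr h))

theorem sigE_mul_sigbE (i : Fin (n - 1)) : sigE n i * sigbE n i = 1 := mkS_eq_of_rel (.ssb i)
theorem sigbE_mul_sigE (i : Fin (n - 1)) : sigbE n i * sigE n i = 1 := mkS_eq_of_rel (.sbs i)

theorem isLocalFamily_sigb (n : ℕ) :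
    IsLocalFamily (rhoC n) (fun k => mkS n (WsbN n k)) (n - 1) where
  far i j hi hj h := by
    have h0 := (isLocalFamily_sig n).far i j hi hj h
    have h1 := mkS_WsN ⟨i, hi⟩
    have h2 := mkS_WsbN ⟨i, hi⟩
    simp only at h0 h1 h2 ⊢
    refine left_inv_eq_right_inv (a := mkS n (WsN n i)) ?_ ?_
    · conv_lhs => rw [← h0]
      rw [← smul_mul', h1, h2, sigbE_mul_sigE, smul_one]
    · rw [h1, h2, sigE_mul_sigbE]
  slide i hi := by
    have h0 := (isLocalFamily_sig n).slide i hi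
    have h1 := mkS_WsN (n := n) ⟨i, by omega⟩
    have h2 := mkS_WsbN (n := n) ⟨i, by omega⟩
    have h3 := mkS_WsN ⟨i + 1, hi⟩
    have h4 := mkS_WsbN ⟨i + 1, hi⟩
    simp only at h0 h1 h2 h3 h4 ⊢
    refine left_inv_eq_right_inv (a := rhoC n i • mkS n (WsN n (i + 1))) ?_ ?_
    · rw [← smul_mul', h3, h4, sigbE_mul_sigE, smul_one]
    · rw [h0, ← smul_mul', h1, h2, sigE_mul_sigbE, smul_one]

theorem rhoC_smul_pairFamily {s : ℕ → STVB n} (hs : IsLocalFamily (rhoC n) s (n - 1))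
    (i : Fin (n - 1)) {k l : Fin n} (h : k ≠ l) :
    rhoC n i • pairFamily (rhoC n) s k l = pairFamily (rhoC n) s (swp i k) (swp i l) := by
  rw [hs.smul_pairFamily (isCoxeterTypeA_rhoC n) (Fin.val_ne_of_ne h) (by omega) (by omega)
    i.isLt, val_swp, val_swp]

theorem rhoC_smul_gamE (i : Fin (n - 1)) (j : Fin n) :
    rhoC n i • gamE n j = gamE n (swp i j) := by
  have h : gamE n (fb i) * rhoE n i = rhoE n i * gamE n (fa i) := mkS_eq_of_rel (.grel i)
  rw [rhoC_smul]
  by_cases h1 : j = fa i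
  · rw [h1, swp_fa, ← h, mul_assoc, rhoE_mul_self, mul_one]
  by_cases h2 : j = fb i
  · rw [h2, swp_fb, mul_assoc, h, ← mul_assoc, rhoE_mul_self, one_mul]
  have h3 : gamE n j * rhoE n i = rhoE n i * gamE n j := mkS_eq_of_rel (.grc h1 h2)
  rw [swp_of_ne h1 h2, mul_assoc, h3, ← mul_assoc, rhoE_mul_self, one_mul]

end SingTVB

namespace SingTVH

open SingTVB

variable {n : ℕ}

/-- The action of the generators of `STVB n` on `HM n`: the braid-like generators act by left
multiplication and `ρ_i` acts by relabelling the strands. -/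
def genAct : Gen n → Function.End (HM n)
  | .sig i => fun x => uH (fa i) (fb i) * x
  | .sigb i => fun x => ubH (fa i) (fb i) * x
  | .rho i => fun x => relabel (swp i) x
  | .tau i => fun x => wH (fa i) (fb i) * x
  | .gam j => fun x => cH j * x

theorem genAct_sig (i : Fin (n - 1)) (x : HM n) :
    genAct (.sig i) x = uH (fa i) (fb i) * x := rfl

theorem genAct_sigb (i : Fin (n - 1)) (x : HM n) :
    genAct (.sigb i) x = ubH (fa i) (fb i) * x := rfl

theorem genAct_rho (i : Fin (n - 1)) (x : HM n) : genAct (.rho i) x = relabel (swp i) x := rfl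

theorem genAct_tau (i : Fin (n - 1)) (x : HM n) :
    genAct (.tau i) x = wH (fa i) (fb i) * x := rfl

theorem genAct_gam (j : Fin n) (x : HM n) : genAct (.gam j) x = cH j * x := rfl

theorem end_mul_apply {α : Type*} (f g : Function.End α) (x : α) : (f * g) x = f (g x) := rfl

theorem end_one_apply {α : Type*} (x : α) : (1 : Function.End α) x = x := rfl

theorem genAct_rel {a b : FM n} (h : Rel n a b) :
    FreeMonoid.lift genAct a = FreeMonoid.lift genAct b := by
  have H := isHFamily_HM n
  cases h <;> funext x <;>
    simp only [Ws, Wsb, Wr, Wt, Wg, map_mul, map_one, FreeMonoid.lift_eval_of, end_mul_apply,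
      end_one_apply, genAct_sig, genAct_sigb, genAct_rho, genAct_tau, genAct_gam, ← mul_assoc,
      relabel_relabel]
  case ss i j h =>
    rw [H.uu _ _ _ _ (fa_ne_fb i) (fa_ne_fb j) h.ne.1 h.ne.2.1 h.ne.2.2.1 h.ne.2.2.2]
  case rr i j h => rw [swp_comm h]
  case sr i j h =>
    rw [relabel_u _ (fa_ne_fb i), swp_of_ne h.ne.1 h.ne.2.1, swp_of_ne h.ne.2.2.1 h.ne.2.2.2]
  case tt i j h =>
    rw [H.ww _ _ _ _ (fa_ne_fb i) (fa_ne_fb j) h.ne.1 h.ne.2.1 h.ne.2.2.1 h.ne.2.2.2]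
  case st i j h =>
    rw [H.uw _ _ _ _ (fa_ne_fb i) (fa_ne_fb j) h.ne.1 h.ne.2.1 h.ne.2.2.1 h.ne.2.2.2]
  case tr i j h =>
    rw [relabel_w _ (fa_ne_fb i), swp_of_ne h.ne.1 h.ne.2.1, swp_of_ne h.ne.2.2.1 h.ne.2.2.2]
  case sss i j h =>
    have h1 := fa_ne_fb j
    rw [fa_eq_fb h] at *
    rw [H.uuu _ _ _ (fa_ne_fb i) h1 (fa_ne_fb_of_succ h)]
  case rrr i j h => rw [swp_braid h]
  case rsr i j h =>
    have h1 := fa_ne_fb j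
    have h2 : swp j (fb i) = fb j := by rw [← fa_eq_fb h, swp_fa]
    have h3 := fa_ne_fb_of_succ h
    rw [relabel_u _ (fa_ne_fb i), relabel_u _ h1, h2]
    rw [fa_eq_fb h] at *
    rw [swp_fb, swp_of_ne h3.symm h1.symm, swp_of_ne (fa_eq_fb h ▸ fa_ne_fb i) h3, swp_mul_self,
      swp_mul_self]
  case rtr i j h =>
    have h1 := fa_ne_fb j
    have h2 : swp j (fb i) = fb j := by rw [← fa_eq_fb h, swp_fa]
    have h3 := fa_ne_fb_of_succ h
    rw [relabel_w _ (fa_ne_fb i), relabel_w _ h1, h2]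
    rw [fa_eq_fb h] at *
    rw [swp_fb, swp_of_ne h3.symm h1.symm, swp_of_ne (fa_eq_fb h ▸ fa_ne_fb i) h3, swp_mul_self,
      swp_mul_self]
  case sst i j h =>
    have h1 := fa_ne_fb j
    rw [fa_eq_fb h] at *
    rw [H.uuw _ _ _ (fa_ne_fb i) h1 (fa_ne_fb_of_succ h)]
  case sst' i j h =>
    have h1 := fa_ne_fb j
    rw [fa_eq_fb h] at *
    rw [H.wuu _ _ _ (fa_ne_fb i) h1 (fa_ne_fb_of_succ h)]
  case rho2 i => rw [swp_mul_self, relabel_one]; rfl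
  case ssb i => rw [H.uInv _ _ (fa_ne_fb i), one_mul]
  case sbs i => rw [H.uInv' _ _ (fa_ne_fb i), one_mul]
  case stc i => rw [H.uwSame _ _ (fa_ne_fb i)]
  case grel i => rw [relabel_c, swp_fa]
  case rsrg i =>
    rw [relabel_u _ (fa_ne_fb i), swp_fa, swp_fb, swp_mul_self, relabel_one,
      H.uSym _ _ (fa_ne_fb i).symm]
    rfl
  case rtrg i =>
    rw [relabel_w _ (fa_ne_fb i), swp_fa, swp_fb, swp_mul_self, relabel_one,
      H.wSym _ _ (fa_ne_fb i).symm]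
    rfl
  case g2 j => rw [H.c2, one_mul]
  case gg i j =>
    by_cases h : i = j
    · rw [h]
    · rw [H.cc _ _ h]
  case grc i j h1 h2 => rw [relabel_c, swp_of_ne h1 h2]
  case sgc i j h1 h2 => rw [H.uc _ _ _ (fa_ne_fb i) h1 h2]
  case tgc i j h1 h2 => rw [H.wc _ _ _ (fa_ne_fb i) h1 h2]

/-- The action of `STVB n` on `HM n`. -/
def stvbAct (n : ℕ) : STVB n →* Function.End (HM n) :=
  PresentedMonoid.lift genAct fun _ _ h => genAct_rel h

/-- Conjugation by `g` permutes the generators of the pure part of `STVB n` by `p`, and `g` acts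
on `HM n` by relabelling along `p`. -/
structure Transports (g : ConjAct (STVB n)ˣ) (p : Equiv.Perm (Fin n)) : Prop where
  xel (k l) : k ≠ l → g • SingTVB.xel n k l = SingTVB.xel n (p k) (p l)
  xBar (k l) : k ≠ l → g • SingTVB.xBar n k l = SingTVB.xBar n (p k) (p l)
  zel (k l) : k ≠ l → g • SingTVB.zel n k l = SingTVB.zel n (p k) (p l)
  gamE (j) : g • SingTVB.gamE n j = SingTVB.gamE n (p j)
  act (x) : stvbAct n (conjVal g) x = relabel p x

namespace Transports

theorem one : Transports (1 : ConjAct (STVB n)ˣ) 1 where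
  xel _ _ _ := one_smul _ _
  xBar _ _ _ := one_smul _ _
  zel _ _ _ := one_smul _ _
  gamE _ := one_smul _ _
  act x := by rw [relabel_one, conjVal_one, map_one]; rfl

theorem mul {g h : ConjAct (STVB n)ˣ} {p q : Equiv.Perm (Fin n)} (hg : Transports g p)
    (hh : Transports h q) : Transports (g * h) (p * q) where
  xel k l hkl := by rw [mul_smul, hh.xel k l hkl, hg.xel _ _ (q.injective.ne hkl)]; rfl
  xBar k l hkl := by rw [mul_smul, hh.xBar k l hkl, hg.xBar _ _ (q.injective.ne hkl)]; rfl
  zel k l hkl := by rw [mul_smul, hh.zel k l hkl, hg.zel _ _ (q.injective.ne hkl)]; rfl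
  gamE j := by rw [mul_smul, hh.gamE, hg.gamE]; rfl
  act x := by
    rw [conjVal_mul, map_mul, end_mul_apply, hh.act, hg.act,
      relabel_relabel]

theorem rhoC (i : Fin (n - 1)) : Transports (SingTVB.rhoC n i) (swp i) where
  xel k l h := by
    rw [xel_eq, xel_eq]; exact rhoC_smul_pairFamily (isLocalFamily_sig n) i h
  xBar k l h := by
    rw [xBar_eq, xBar_eq]; exact rhoC_smul_pairFamily (isLocalFamily_sigb n) i h
  zel k l h := by
    rw [zel_eq, zel_eq]; exact rhoC_smul_pairFamily (isLocalFamily_tau n) i h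
  gamE j := rhoC_smul_gamE i j
  act x := by rw [conjVal_rhoC]; rfl

theorem exists_of_perm (p : Equiv.Perm (Fin n)) : ∃ g, Transports g p := by
  have hp : p ∈ Submonoid.closure (Set.range (swp (n := n))) := by
    rw [closure_swp]; exact Submonoid.mem_top p
  induction hp using Submonoid.closure_induction with
  | mem _ h => obtain ⟨i, rfl⟩ := h; exact ⟨_, rhoC i⟩
  | one => exact ⟨1, one⟩
  | mul _ _ _ _ hx hy =>
    obtain ⟨g, hg⟩ := hx
    obtain ⟨h, hh⟩ := hy
    exact ⟨g * h, hg.mul hh⟩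

/-- Every injective tuple of strands is transported from the initial tuple. -/
theorem exists_of_injective {d : ℕ} (f : Fin d → Fin n) (hf : Function.Injective f) :
    ∃ (hd : d ≤ n) (g : ConjAct (STVB n)ˣ) (p : Equiv.Perm (Fin n)), Transports g p ∧
      ∀ a, p (Fin.castLE hd a) = f a := by
  have hd : d ≤ n := by simpa using Fintype.card_le_of_injective f hf
  obtain ⟨p, hp⟩ := Equiv.Perm.exists_extending_pair (Fin.castLE hd) f
    (Fin.castLE_injective hd) hf
  obtain ⟨g, hg⟩ := exists_of_perm p
  exact ⟨hd, g, p, hg, hp⟩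

theorem exists_pair {k l : Fin n} (h : k ≠ l) :
    ∃ (i : Fin (n - 1)) (g : ConjAct (STVB n)ˣ) (p : Equiv.Perm (Fin n)), Transports g p ∧
      p (fa i) = k ∧ p (fb i) = l := by
  obtain ⟨hd, g, p, hg, hp⟩ := exists_of_injective ![k, l] (by
    simp [Function.Injective, Fin.forall_fin_succ, h, h.symm])
  exact ⟨⟨0, by omega⟩, g, p, hg, hp 0, hp 1⟩

theorem exists_triple {k l m : Fin n} (hkl : k ≠ l) (hkm : k ≠ m) (hlm : l ≠ m) :
    ∃ (i j : Fin (n - 1)) (g : ConjAct (STVB n)ˣ) (p : Equiv.Perm (Fin n)), Transports g p ∧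
      j.val = i.val + 1 ∧ p (fa i) = k ∧ p (fb i) = l ∧ p (fa j) = l ∧ p (fb j) = m := by
  obtain ⟨hd, g, p, hg, hp⟩ := exists_of_injective ![k, l, m] (by
    simp [Function.Injective, Fin.forall_fin_succ, hkl, hkm, hlm, hkl.symm, hkm.symm, hlm.symm])
  exact ⟨⟨0, by omega⟩, ⟨1, by omega⟩, g, p, hg, rfl, hp 0, hp 1, hp 1, hp 2⟩

theorem exists_quadruple {k l m o : Fin n} (hkl : k ≠ l) (hmo : m ≠ o) (hkm : k ≠ m)
    (hko : k ≠ o) (hlm : l ≠ m) (hlo : l ≠ o) :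
    ∃ (i j : Fin (n - 1)) (g : ConjAct (STVB n)ˣ) (p : Equiv.Perm (Fin n)), Transports g p ∧
      Far i j ∧ p (fa i) = k ∧ p (fb i) = l ∧ p (fa j) = m ∧ p (fb j) = o := by
  obtain ⟨hd, g, p, hg, hp⟩ := exists_of_injective ![k, l, m, o] (by
    simp [Function.Injective, Fin.forall_fin_succ, hkl, hkm, hlm, hkl.symm, hkm.symm, hlm.symm,
      hmo, hmo.symm, hko, hko.symm, hlo, hlo.symm])
  exact ⟨⟨0, by omega⟩, ⟨2, by omega⟩, g, p, hg, Or.inl (by simp), hp 0, hp 1, hp 2, hp 3⟩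

theorem smul_sigE {g : ConjAct (STVB n)ˣ} {p : Equiv.Perm (Fin n)}
    (hg : Transports g p) (i : Fin (n - 1)) :
    g • sigE n i = SingTVB.xel n (p (fa i)) (p (fb i)) := by
  rw [← xel_fa_fb, hg.xel _ _ (fa_ne_fb i)]

theorem smul_sigbE {g : ConjAct (STVB n)ˣ} {p : Equiv.Perm (Fin n)}
    (hg : Transports g p) (i : Fin (n - 1)) :
    g • sigbE n i = SingTVB.xBar n (p (fa i)) (p (fb i)) := by
  rw [← xBar_fa_fb, hg.xBar _ _ (fa_ne_fb i)]

theorem smul_tauE {g : ConjAct (STVB n)ˣ} {p : Equiv.Perm (Fin n)}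
    (hg : Transports g p) (i : Fin (n - 1)) :
    g • tauE n i = SingTVB.zel n (p (fa i)) (p (fb i)) := by
  rw [← zel_fa_fb, hg.zel _ _ (fa_ne_fb i)]

theorem xel_fb_fa (i : Fin (n - 1)) :
    SingTVB.xel n (fb i) (fa i) = rhoE n i * sigE n i * rhoE n i := by
  rw [← rhoC_smul, (rhoC i).smul_sigE, swp_fa, swp_fb]

theorem zel_fb_fa (i : Fin (n - 1)) :
    SingTVB.zel n (fb i) (fa i) = rhoE n i * tauE n i * rhoE n i := by
  rw [← rhoC_smul, (rhoC i).smul_tauE, swp_fa, swp_fb]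

end Transports

theorem isHFamily_STVB (n : ℕ) : IsHFamily (xel n) (xBar n) (zel n) (gamE n) where
  c2 j := mkS_eq_of_rel (.g2 j)
  cc i j _ := mkS_eq_of_rel (.gg i j)
  uInv k l h := by
    obtain ⟨i, g, p, hg, rfl, rfl⟩ := Transports.exists_pair h
    rw [← hg.smul_sigE, ← hg.smul_sigbE, ← smul_mul', sigE_mul_sigbE, smul_one]
  uInv' k l h := by
    obtain ⟨i, g, p, hg, rfl, rfl⟩ := Transports.exists_pair h
    rw [← hg.smul_sigE, ← hg.smul_sigbE, ← smul_mul', sigbE_mul_sigE, smul_one]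
  uu k l m o h h' h1 h2 h3 h4 := by
    obtain ⟨i, j, g, p, hg, hij, rfl, rfl, rfl, rfl⟩ :=
      Transports.exists_quadruple h h' h1 h2 h3 h4
    rw [← hg.smul_sigE, ← hg.smul_sigE, ← smul_mul', ← smul_mul']
    exact congrArg (g • ·) (mkS_eq_of_rel (.ss hij))
  uw k l m o h h' h1 h2 h3 h4 := by
    obtain ⟨i, j, g, p, hg, hij, rfl, rfl, rfl, rfl⟩ :=
      Transports.exists_quadruple h h' h1 h2 h3 h4
    rw [← hg.smul_sigE, ← hg.smul_tauE, ← smul_mul', ← smul_mul']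
    exact congrArg (g • ·) (mkS_eq_of_rel (.st hij))
  ww k l m o h h' h1 h2 h3 h4 := by
    obtain ⟨i, j, g, p, hg, hij, rfl, rfl, rfl, rfl⟩ :=
      Transports.exists_quadruple h h' h1 h2 h3 h4
    rw [← hg.smul_tauE, ← hg.smul_tauE, ← smul_mul', ← smul_mul']
    exact congrArg (g • ·) (mkS_eq_of_rel (.tt hij))
  uuu k m l h1 h2 h3 := by
    obtain ⟨i, j, g, p, hg, hij, rfl, rfl, hp, rfl⟩ := Transports.exists_triple h1 h3 h2
    have h := hg.smul_sigE j
    rw [hp] at h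
    simp only [← hg.smul_sigE, ← h, ← smul_mul']
    exact congrArg (g • ·) (mkS_eq_of_rel (.sss hij))
  uuw k m l h1 h2 h3 := by
    obtain ⟨i, j, g, p, hg, hij, rfl, rfl, hp, rfl⟩ := Transports.exists_triple h1 h3 h2
    have h := hg.smul_sigE j
    have h' := hg.smul_tauE j
    rw [hp] at h h'
    simp only [← hg.smul_sigE, ← hg.smul_tauE, ← h, ← h', ← smul_mul']
    exact congrArg (g • ·) (mkS_eq_of_rel (.sst hij))
  wuu k m l h1 h2 h3 := by
    obtain ⟨i, j, g, p, hg, hij, rfl, rfl, hp, rfl⟩ := Transports.exists_triple h1 h3 h2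
    have h := hg.smul_sigE j
    have h' := hg.smul_tauE j
    rw [hp] at h h'
    simp only [← hg.smul_sigE, ← hg.smul_tauE, ← h, ← h', ← smul_mul']
    exact congrArg (g • ·) (mkS_eq_of_rel (.sst' hij)).symm
  uc k l m h h1 h2 := by
    obtain ⟨i, j, g, p, hg, hij, rfl, rfl, hp, rfl⟩ := Transports.exists_triple h h1.symm h2.symm
    rw [← hg.smul_sigE, ← hg.gamE, ← smul_mul', ← smul_mul']
    exact congrArg (g • ·) (mkS_eq_of_rel (.sgc (ne_of_apply_ne p h1) (ne_of_apply_ne p h2)))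
  wc k l m h h1 h2 := by
    obtain ⟨i, j, g, p, hg, hij, rfl, rfl, hp, rfl⟩ := Transports.exists_triple h h1.symm h2.symm
    rw [← hg.smul_tauE, ← hg.gamE, ← smul_mul', ← smul_mul']
    exact congrArg (g • ·) (mkS_eq_of_rel (.tgc (ne_of_apply_ne p h1) (ne_of_apply_ne p h2)))
  uwSame k l h := by
    obtain ⟨i, g, p, hg, rfl, rfl⟩ := Transports.exists_pair h
    rw [← hg.smul_sigE, ← hg.smul_tauE, ← smul_mul', ← smul_mul']
    exact congrArg (g • ·) (mkS_eq_of_rel (.stc i))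
  uSym k l h := by
    obtain ⟨i, g, p, hg, rfl, rfl⟩ := Transports.exists_pair h.symm
    rw [← hg.smul_sigE, ← hg.gamE, ← hg.gamE, ← hg.xel _ _ (fa_ne_fb i).symm,
      Transports.xel_fb_fa]
    simp only [← smul_mul']
    exact congrArg (g • ·) (mkS_eq_of_rel (.rsrg i))
  wSym k l h := by
    obtain ⟨i, g, p, hg, rfl, rfl⟩ := Transports.exists_pair h.symm
    rw [← hg.smul_tauE, ← hg.gamE, ← hg.gamE, ← hg.zel _ _ (fa_ne_fb i).symm,
      Transports.zel_fb_fa]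
    simp only [← smul_mul']
    exact congrArg (g • ·) (mkS_eq_of_rel (.rtrg i))

/-- The homomorphism `HM n → STVB n` sending the generators to `x`, `x̄`, `z` and `γ`. -/
def toSTVB (n : ℕ) : HM n →* STVB n := (isHFamily_STVB n).lift

theorem Transports.act_smul {g : ConjAct (STVB n)ˣ} {p : Equiv.Perm (Fin n)}
    (hg : Transports g p) {a : STVB n} {b : HM n} (h : ∀ x, stvbAct n a x = b * x) (x : HM n) :
    stvbAct n (g • a) x = relabel p b * x := by
  have hx : stvbAct n (conjVal g * conjVal g⁻¹) x = x := by
    rw [conjVal_mul_inv, map_one]; rfl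
  rw [map_mul, end_mul_apply, hg.act] at hx
  rw [smul_eq_conjVal, map_mul, map_mul, end_mul_apply, end_mul_apply, h, hg.act, map_mul, hx]

theorem stvbAct_toSTVB (y x : HM n) : stvbAct n (toSTVB n y) x = y * x := by
  let leftMul : HM n →* Function.End (HM n) := MulAction.toEndHom
  suffices h : (stvbAct n).comp (toSTVB n) = leftMul from
    congrArg (fun f : HM n →* Function.End (HM n) => f y x) h
  refine HM.hom_ext (fun k l h => ?_) (fun k l h => ?_) (fun k l h => ?_) (fun _ => rfl) <;>
    obtain ⟨i, g, p, hg, rfl, rfl⟩ := Transports.exists_pair h <;> funext x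
  · change stvbAct n (toSTVB n _) x = _ * x
    rw [toSTVB, IsHFamily.lift_u _ h, ← hg.smul_sigE,
      hg.act_smul (b := uH (fa i) (fb i)) (fun _ => rfl), relabel_u _ (fa_ne_fb i)]
  · change stvbAct n (toSTVB n _) x = _ * x
    rw [toSTVB, IsHFamily.lift_ub _ h, ← hg.smul_sigbE,
      hg.act_smul (b := ubH (fa i) (fb i)) (fun _ => rfl), relabel_ub _ (fa_ne_fb i)]
  · change stvbAct n (toSTVB n _) x = _ * x
    rw [toSTVB, IsHFamily.lift_w _ h, ← hg.smul_tauE,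
      hg.act_smul (b := wH (fa i) (fb i)) (fun _ => rfl), relabel_w _ (fa_ne_fb i)]

theorem toSTVB_injective (n : ℕ) : Function.Injective (toSTVB n) := fun y z h => by
  rw [← mul_one y, ← mul_one z, ← stvbAct_toSTVB, ← stvbAct_toSTVB, h]

theorem Transports.smul_toSTVB {g : ConjAct (STVB n)ˣ} {p : Equiv.Perm (Fin n)}
    (hg : Transports g p) (y : HM n) : g • toSTVB n y = toSTVB n (relabel p y) := by
  let conj : STVB n →* STVB n := MulDistribMulAction.toMonoidHom _ g
  suffices h : conj.comp (toSTVB n) = (toSTVB n).comp (relabel p) from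
    congrArg (fun f : HM n →* STVB n => f y) h
  refine HM.hom_ext (fun k l h => ?_) (fun k l h => ?_) (fun k l h => ?_) (fun j => hg.gamE j)
  · change g • toSTVB n _ = toSTVB n (relabel p _)
    rw [relabel_u _ h, toSTVB, IsHFamily.lift_u _ h, IsHFamily.lift_u _ (p.injective.ne h),
      hg.xel _ _ h]
  · change g • toSTVB n _ = toSTVB n (relabel p _)
    rw [relabel_ub _ h, toSTVB, IsHFamily.lift_ub _ h, IsHFamily.lift_ub _ (p.injective.ne h),
      hg.xBar _ _ h]
  · change g • toSTVB n _ = toSTVB n (relabel p _)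
    rw [relabel_w _ h, toSTVB, IsHFamily.lift_w _ h, IsHFamily.lift_w _ (p.injective.ne h),
      hg.zel _ _ h]

/-- Every element of `STVB n` factors as a pure element times a product of the `ρ_i`. -/
theorem exists_eq_toSTVB_mul (a : STVB n) :
    ∃ y : HM n, ∃ g ∈ Submonoid.closure (rhoC n '' Set.Iio (n - 1)),
      a = toSTVB n y * conjVal g := by
  obtain ⟨a, rfl⟩ := PresentedMonoid.surjective_mk a
  have left (b c : STVB n) (y : HM n) (hb : b = toSTVB n y)
      (hc : ∃ y : HM n, ∃ g ∈ Submonoid.closure (rhoC n '' Set.Iio (n - 1)),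
        c = toSTVB n y * conjVal g) :
      ∃ y : HM n, ∃ g ∈ Submonoid.closure (rhoC n '' Set.Iio (n - 1)),
        b * c = toSTVB n y * conjVal g := by
    obtain ⟨z, g, hg, rfl⟩ := hc
    exact ⟨y * z, g, hg, by rw [hb, map_mul, mul_assoc]⟩
  induction a using FreeMonoid.inductionOn' with
  | one => exact ⟨1, 1, one_mem _, by simp⟩
  | of_mul s b ih =>
    rw [map_mul]
    cases s with
    | sig i =>
      exact left _ _ (uH (fa i) (fb i)) (by
        rw [toSTVB, IsHFamily.lift_u _ (fa_ne_fb i), xel_fa_fb]; rfl) ih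
    | sigb i =>
      exact left _ _ (ubH (fa i) (fb i)) (by
        rw [toSTVB, IsHFamily.lift_ub _ (fa_ne_fb i), xBar_fa_fb]; rfl) ih
    | tau i =>
      exact left _ _ (wH (fa i) (fb i)) (by
        rw [toSTVB, IsHFamily.lift_w _ (fa_ne_fb i), zel_fa_fb]; rfl) ih
    | gam j => exact left _ _ (cH j) rfl ih
    | rho i =>
      obtain ⟨z, g, hg, hb⟩ := ih
      refine ⟨relabel (swp i) z, rhoC n i * g,
        mul_mem (Submonoid.subset_closure ⟨i, i.isLt, rfl⟩) hg, ?_⟩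
      change rhoE n i * _ = _
      rw [hb, ← (Transports.rhoC i).smul_toSTVB, conjVal_mul, ← mul_assoc, ← mul_assoc,
        ← conjVal_mul_eq_smul, conjVal_rhoC]

section Kernel

variable (φ : STVB n →* Equiv.Perm (Fin n))

theorem map_smul_eq_one (g : ConjAct (STVB n)ˣ) {a : STVB n} (h : φ a = 1) : φ (g • a) = 1 := by
  rw [smul_eq_conjVal, map_mul, map_mul, h, mul_one, ← map_mul, conjVal_mul_inv, map_one]

/-- The action on strands, extended to all natural numbers. -/
noncomputable def natPerm : ConjAct (STVB n)ˣ →* Equiv.Perm ℕ :=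
  (Equiv.Perm.viaEmbeddingHom Fin.valEmbedding).comp
    ((φ.comp (Units.coeHom (STVB n))).comp ConjAct.ofConjAct.toMonoidHom)

theorem natPerm_eq (g : ConjAct (STVB n)ˣ) :
    natPerm φ g = (φ (conjVal g)).viaEmbedding Fin.valEmbedding := rfl

theorem viaEmbedding_swp (i : Fin (n - 1)) :
    (swp i).viaEmbedding Fin.valEmbedding = Equiv.swap i.val (i.val + 1) := by
  ext k
  by_cases h : k < n
  · have := (swp i).viaEmbedding_apply Fin.valEmbedding ⟨k, h⟩
    simp only [Fin.valEmbedding_apply] at this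
    rw [this, val_swp]
  · rw [Equiv.Perm.viaEmbedding_apply_of_notMem _ _ _ (by simpa using h),
      Equiv.swap_apply_of_ne_of_ne (by omega) (by omega)]

theorem eq_one_of_mem_closure_rhoC (hr : ∀ i : Fin (n - 1), φ (rhoE n i) = swp i)
    {g : ConjAct (STVB n)ˣ} (hg : g ∈ Submonoid.closure (rhoC n '' Set.Iio (n - 1)))
    (h : φ (conjVal g) = 1) : g = 1 := by
  refine (isCoxeterTypeA_rhoC n).eq_one_of_mem_closure (natPerm φ) (fun i hi => ?_) le_rfl hg ?_
  · have := conjVal_rhoC ⟨i, hi⟩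
    simp only at this
    rw [natPerm_eq, this, hr, viaEmbedding_swp]
  · rw [natPerm_eq, h]
    exact map_one (Equiv.Perm.viaEmbeddingHom Fin.valEmbedding)

theorem map_toSTVB (hs : ∀ i : Fin (n - 1), φ (sigE n i) = 1)
    (hsb : ∀ i : Fin (n - 1), φ (sigbE n i) = 1) (ht : ∀ i : Fin (n - 1), φ (tauE n i) = 1)
    (hg : ∀ j : Fin n, φ (gamE n j) = 1) (y : HM n) : φ (toSTVB n y) = 1 := by
  suffices h : φ.comp (toSTVB n) = 1 from
    congrArg (fun f : HM n →* Equiv.Perm (Fin n) => f y) h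
  refine HM.hom_ext (fun k l h => ?_) (fun k l h => ?_) (fun k l h => ?_) (fun j => hg j) <;>
    obtain ⟨i, g, p, hg, rfl, rfl⟩ := Transports.exists_pair h <;>
    rw [MonoidHom.comp_apply, toSTVB, MonoidHom.one_apply]
  · rw [IsHFamily.lift_u _ h, ← hg.smul_sigE, map_smul_eq_one φ g (hs i)]
  · rw [IsHFamily.lift_ub _ h, ← hg.smul_sigbE, map_smul_eq_one φ g (hsb i)]
  · rw [IsHFamily.lift_w _ h, ← hg.smul_tauE, map_smul_eq_one φ g (ht i)]

end Kernel

end SingTVH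

open SingTVB SingTVH in
/-- the assignment `u_{k,l} ↦ x_{k,l}`, `ū_{k,l} ↦ x̄_{k,l}`, `w_{k,l} ↦ z_{k,l}`,
`c_j ↦ γ_j` defines a monoid homomorphism from the abstractly presented monoid `H n` to
`STVB n` which is an isomorphism of `H n` onto the submonoid `STVH n = φ₂⁻¹(1)`. -/
theorem stvh_presentation (n : ℕ) (hn : 2 ≤ n) (φ : STVB n →* Equiv.Perm (Fin n))
    (hs : ∀ i : Fin (n - 1), φ (sigE n i) = 1)
    (hsb : ∀ i : Fin (n - 1), φ (sigbE n i) = 1)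
    (ht : ∀ i : Fin (n - 1), φ (tauE n i) = 1)
    (hr : ∀ i : Fin (n - 1), φ (rhoE n i) = swp i)
    (hg : ∀ j : Fin n, φ (gamE n j) = 1) :
    ∃ ψ : HM n →* STVB n,
      (∀ (k l : Fin n) (h : k ≠ l), ψ (mkH n (wu k l h)) = xel n k l) ∧
      (∀ (k l : Fin n) (h : k ≠ l), ψ (mkH n (wub k l h)) = xBar n k l) ∧
      (∀ (k l : Fin n) (h : k ≠ l), ψ (mkH n (ww k l h)) = zel n k l) ∧
      (∀ j : Fin n, ψ (mkH n (wc j)) = gamE n j) ∧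
      Function.Injective ψ ∧
      MonoidHom.mrange ψ = MonoidHom.mker φ := by
  refine ⟨toSTVB n, fun k l h => ?_, fun k l h => ?_, fun k l h => ?_, fun _ => rfl,
    toSTVB_injective n, le_antisymm ?_ fun a ha => ?_⟩
  · rw [← uH_of_ne h]; exact IsHFamily.lift_u _ h
  · rw [← ubH_of_ne h]; exact IsHFamily.lift_ub _ h
  · rw [← wH_of_ne h]; exact IsHFamily.lift_w _ h
  · rintro _ ⟨y, rfl⟩
    exact MonoidHom.mem_mker.2 (map_toSTVB φ hs hsb ht hg y)
  · obtain ⟨y, g, hgc, rfl⟩ := exists_eq_toSTVB_mul a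
    rw [MonoidHom.mem_mker, map_mul, map_toSTVB φ hs hsb ht hg, one_mul] at ha
    exact ⟨y, by rw [eq_one_of_mem_closure_rhoC φ hr hgc ha, conjVal_one, mul_one]⟩
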